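/- Let n be a positive integer, let p₁,…,pₙ be distinct prime numbers, and let m₁,…,mₙ be positive integers with m₁ + ⋯ + mₙ > n. Then there exists a finite simple solution (X,r) of the YBE of cardinality |X| = p₁^{m₁} ⋯ pₙ^{mₙ}. -/

import Mathlib

open Function

/-- The map `r₁₂ = r × id` on `X³`. -/
def yb12 {X : Type*} (r : X × X → X × X) : X × X × X → X × X × X :=
  fun p => ((r (p.1, p.2.1)).1, ((r (p.1, p.2.1)).2, p.2.2))

/-- The map `r₂₃ = id × r` on `X³`. -/
def yb23 {X : Type*} (r : X × X → X × X) : X × X × X → X × X × X :=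
  fun p => (p.1, r p.2)

/-- `(X, r)` is an involutive non-degenerate set-theoretic solution of the
Yang–Baxter equation. -/
structure IsYBSolution {X : Type*} (r : X × X → X × X) : Prop where
  invol : ∀ p, r (r p) = p
  sigma_bij : ∀ x, Function.Bijective (fun y => (r (x, y)).1)
  gamma_bij : ∀ y, Function.Bijective (fun x => (r (x, y)).2)
  braid : yb12 r ∘ yb23 r ∘ yb12 r = yb23 r ∘ yb12 r ∘ yb23 r

/-- A homomorphism of solutions: `f (σ_x y) = σ'_{f x} (f y)`. -/
def IsSolHom {X Y : Type*} (r : X × X → X × X) (s : Y × Y → Y × Y) (f : X → Y) : Prop :=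
  ∀ x y, f (r (x, y)).1 = (s (f x, f y)).1

/-- The permutation group `G(X,r)`: the subgroup of `Sym(X)` generated by the
permutations `σ_x`. -/
def permGroup {X : Type*} (r : X × X → X × X) : Subgroup (Equiv.Perm X) :=
  Subgroup.closure {g : Equiv.Perm X | ∃ x, ∀ y, g y = (r (x, y)).1}

/-- `(X,r)` is indecomposable: `G(X,r)` acts transitively on `X`. -/
def IsIndecomposable {X : Type*} (r : X × X → X × X) : Prop :=
  ∀ x y : X, ∃ g ∈ permGroup r, g x = y

/-- `(X,r)` is irretractable: `σ_x = σ_y` implies `x = y`. -/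
def IsIrretractable {X : Type*} (r : X × X → X × X) : Prop :=
  ∀ x y : X, (∀ z, (r (x, z)).1 = (r (y, z)).1) → x = y

/-- `(X,r)` is a simple solution: `|X| > 1` and every surjective homomorphism of
solutions from `(X,r)` is either bijective or has a one-element target. -/
def IsSimpleSolution {X : Type u} (r : X × X → X × X) : Prop :=
  Nontrivial X ∧ ∀ (Y : Type u) (s : Y × Y → Y × Y), IsYBSolution s →
    ∀ f : X → Y, Function.Surjective f → IsSolHom r s f →
      Function.Bijective f ∨ Subsingleton Y

section General

variable {X : Type*}

/-- The solution attached to a family of permutations `L`. -/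
def cycR (L : X → Equiv.Perm X) : X × X → X × X :=
  fun q => ((L q.1).symm q.2, L ((L q.1).symm q.2) q.1)

theorem cycR_apply (L : X → Equiv.Perm X) (x y : X) : cycR L (x, L x y) = (y, L y x) := by
  simp [cycR]

theorem cycR_isYB (L : X → Equiv.Perm X)
    (hc : ∀ x y z, L (L x y) (L x z) = L (L y x) (L y z))
    (hg : ∀ y, Function.Bijective (fun x => (cycR L (x, y)).2)) : IsYBSolution (cycR L) := by
  refine ⟨?_, ?_, hg, ?_⟩
  · rintro ⟨x, y⟩
    obtain ⟨y, rfl⟩ := (L x).surjective y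
    rw [cycR_apply, cycR_apply]
  · intro x
    exact (L x).symm.bijective
  · funext ⟨x, y, z⟩
    obtain ⟨y, rfl⟩ := (L x).surjective y
    obtain ⟨z, rfl⟩ := (L (L x y)).surjective z
    obtain ⟨z, rfl⟩ := (L x).surjective z
    have h12 : ∀ x y z, yb12 (cycR L) (x, L x y, L (L x y) (L x z))
        = (y, L y x, L (L y x) (L y z)) := by
      intro x y z
      simp only [yb12, cycR_apply, hc x y z]
    have h23 : ∀ x y z, yb23 (cycR L) (x, L x y, L (L x y) (L x z))
        = (x, L x z, L (L x z) (L x y)) := by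
      intro x y z
      simp only [yb23, cycR_apply]
    simp only [Function.comp_apply, h12, h23]

end General

section Concrete

variable {p n : ℕ}

/-- The left multiplication of the cycle set on `ZMod p × ZMod n × ZMod p`. -/
def opL (x : ZMod p × ZMod n × ZMod p) : Equiv.Perm (ZMod p × ZMod n × ZMod p) where
  toFun y := (y.1 - x.2.2, y.2.1 + (if y.1 = x.1 then 1 else 0),
    y.2.2 + (if y.1 = x.1 ∧ y.2.1 = x.2.1 then 1 else 0))
  invFun y := (y.1 + x.2.2, y.2.1 - (if y.1 + x.2.2 = x.1 then 1 else 0),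
    y.2.2 - (if y.1 + x.2.2 = x.1 ∧ y.2.1 - (if y.1 + x.2.2 = x.1 then 1 else 0) = x.2.1
      then 1 else 0))
  left_inv y := by
    simp
  right_inv y := by
    simp

theorem opL_apply (i k a c : ZMod p) (u v : ZMod n) : opL (i, u, a) (k, v, c) =
    (k - a, v + (if k = i then 1 else 0), c + (if k = i ∧ v = u then 1 else 0)) := rfl

theorem opL_symm_apply (i k a c : ZMod p) (u v : ZMod n) : (opL (i, u, a)).symm (k, v, c) =
    (k + a, v - (if k + a = i then 1 else 0),
      c - (if k + a = i ∧ v - (if k + a = i then 1 else 0) = u then 1 else 0)) := rfl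

theorem opL_cyc (x y z : ZMod p × ZMod n × ZMod p) :
    opL (opL x y) (opL x z) = opL (opL y x) (opL y z) := by
  obtain ⟨i, u, a⟩ := x
  obtain ⟨k, v, b⟩ := y
  obtain ⟨m, w, c⟩ := z
  simp only [opL_apply, Prod.mk.injEq, sub_left_inj]
  refine ⟨?_, ?_, ?_⟩
  · have : (k = i ∧ v = u) ↔ (i = k ∧ u = v) := by grind
    simp only [this]
    ring
  · ring
  · by_cases h1 : m = k
    · subst h1
      by_cases h2 : m = i
      · subst h2
        simp
        ring
      · simp [h2]
    · by_cases h2 : m = i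
      · subst h2
        simp [h1]
      · simp [h1, h2]

theorem opL_gamma [NeZero p] [NeZero n] (y : ZMod p × ZMod n × ZMod p) :
    Function.Bijective (fun x => (cycR opL (x, y)).2) := by
  rw [← Finite.injective_iff_bijective]
  obtain ⟨k, v, c⟩ := y
  have key : ∀ (i a : ZMod p) (u : ZMod n), (cycR opL ((i, u, a), (k, v, c))).2 =
      (i - c + (if i - a = k ∧ v = u + 1 then 1 else 0), u + (if i - a = k then 1 else 0),
        a + (if i - a = k ∧ v = u + 1 then 1 else 0)) := by
    intro i a u
    simp only [cycR, opL_symm_apply, opL_apply]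
    have h1 : (k + a = i) ↔ i - a = k := by grind
    have h2 : (i = k + a) ↔ i - a = k := by grind
    simp only [h1, h2]
    by_cases h : i - a = k
    · have h3 : (v - 1 = u) ↔ v = u + 1 := by grind
      have h4 : (u = v - 1) ↔ v = u + 1 := by grind
      simp only [h, true_and, if_true, h3, h4]
      simp only [Prod.mk.injEq, and_true]
      ring
    · simp [h]
  rintro ⟨i, u, a⟩ ⟨i', u', a'⟩ h
  simp only [key, Prod.mk.injEq] at h
  obtain ⟨h1, h2, h3⟩ := h
  have e : i - a = i' - a' := by linear_combination h1 - h3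
  rw [e] at h1 h2 h3
  have e2 : u = u' := by simpa using h2
  subst e2
  have e3 : a = a' := by simpa using h3
  have e4 : i = i' := by simpa using h1
  rw [e3, e4]

theorem fiber_const {Y : Type*} [NeZero p] [NeZero n] (g : ZMod n → ZMod p → Y) (w : ZMod n)
    (h : ∀ v c, g v c = g (v + 1) (c + (if v = w then 1 else 0))) :
    ∀ v c v' c', g v c = g v' c' := by
  have h1 : ∀ j : ℕ, j < n → ∀ c, g (w + 1 + j) c = g (w + 1) c := by
    intro j
    induction j with
    | zero => simp
    | succ j ih =>
      intro hj c
      rw [← ih (by omega) c, h (w + 1 + j) c]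
      have : w + 1 + (j : ZMod n) ≠ w := by
        intro hw
        have h0 : ((j + 1 : ℕ) : ZMod n) = 0 := by
          push_cast
          linear_combination hw
        rw [ZMod.natCast_eq_zero_iff] at h0
        exact absurd (Nat.le_of_dvd (by omega) h0) (by omega)
      rw [if_neg this]
      push_cast
      congr 1 <;> ring
  have h2 : ∀ v c, g v c = g (w + 1) c := by
    intro v c
    have := h1 (v - (w + 1)).val (ZMod.val_lt _) c
    rw [ZMod.natCast_zmod_val] at this
    simpa using this
  have h3 : ∀ c, g (w + 1) c = g (w + 1) (c + 1) := by
    intro c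
    have := h w c
    rw [if_pos rfl] at this
    rw [← this, h2 w c]
  have h4 : ∀ j : ℕ, g (w + 1) (j : ZMod p) = g (w + 1) 0 := by
    intro j
    induction j with
    | zero => simp
    | succ j ih => rw [← ih, h3 j]; push_cast; rfl
  have h5 : ∀ v c, g v c = g (w + 1) 0 := by
    intro v c
    rw [h2, ← h4 c.val, ZMod.natCast_zmod_val]
  intro v c v' c'
  rw [h5, h5 v']

theorem opL_simple [Fact p.Prime] [NeZero n] :
    IsSimpleSolution (cycR (opL (p := p) (n := n))) := by
  have hp : p.Prime := Fact.out
  refine ⟨inferInstance, ?_⟩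
  intro Y s hs f hf hom
  have hS : ∀ x x' y y', f x = f x' → f y = f y' →
      f ((opL x).symm y) = f ((opL x').symm y') := by
    intro x x' y y' hx hy
    have h1 := hom x y
    have h2 := hom x' y'
    rw [hx, hy, ← h2] at h1
    exact h1
  have hL : ∀ x x' y y', f x = f x' → f y = f y' → f (opL x y) = f (opL x' y') := by
    intro x x' y y' hx hy
    apply (hs.sigma_bij (f x)).1
    have h1 := hom x (opL x y)
    have h2 := hom x' (opL x' y')
    rw [cycR_apply] at h1 h2
    change (s (f x, f (opL x y))).1 = (s (f x, f (opL x' y'))).1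
    rw [← h1]
    rw [hx, ← h2]
    exact hy
  have hT : ∀ (t k k' c c' : ZMod p) (v v' : ZMod n), f (k, v, c) = f (k', v', c') →
      f (k + t, v, c) = f (k' + t, v', c') := by
    intro t k k' c c' v v' h
    have := hL (0, 0, 0) (0, 0, 0) _ _ rfl (hS (0, 0, t) (0, 0, t) _ _ rfl h)
    simpa [opL_symm_apply, opL_apply] using this
  -- case of distinct last coordinates
  have c1 : ∀ (i a i' a' : ZMod p) (u u' : ZMod n), a ≠ a' → f (i, u, a) = f (i', u', a') →
      ∀ x y, f x = f y := by
    intro i a i' a' u u' ha h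
    have q : ∀ (k c : ZMod p) (v : ZMod n), ∃ v' c', f (k, v, c) = f (k + (a - a'), v', c') := by
      intro k c v
      have := hL _ _ ((opL (i, u, a)).symm (k, v, c)) _ h rfl
      rw [Equiv.apply_symm_apply, opL_symm_apply, opL_apply] at this
      rw [add_sub_assoc] at this
      exact ⟨_, _, this⟩
    have hs0 : a - a' ≠ 0 := sub_ne_zero.2 ha
    have q2 : ∀ (k c : ZMod p) (v : ZMod n),
        f (k, v, c) = f (k, v + 1, c + (if v = 0 then 1 else 0)) := by
      intro k c v
      obtain ⟨v', c', h1⟩ := q k c v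
      have h2 := hL (k, 0, 0) (k, 0, 0) _ _ rfl h1
      simp only [opL_apply, sub_zero, true_and, if_true, add_eq_left, hs0, if_false,
        false_and, add_zero] at h2
      rw [h2, h1]
    have q3 := fun k : ZMod p => fiber_const (fun v c => f (k, v, c)) 0 (fun v c => q2 k c v)
    have q4 : ∀ k : ZMod p, f (k, 0, 0) = f (k + (a - a'), 0, 0) := by
      intro k
      obtain ⟨v', c', h1⟩ := q k 0 0
      rw [h1]
      exact q3 _ _ _ _ _
    have q5 : ∀ j : ℕ, f ((j : ZMod p) * (a - a'), 0, 0) = f (0, 0, 0) := by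
      intro j
      induction j with
      | zero => simp
      | succ j ih =>
        rw [← ih, q4 ((j : ZMod p) * (a - a'))]
        push_cast
        rw [add_mul, one_mul]
    have q6 : ∀ x, f x = f (0, 0, 0) := by
      rintro ⟨k, v, c⟩
      have h1 := q5 (k * (a - a')⁻¹).val
      rw [ZMod.natCast_zmod_val, inv_mul_cancel_right₀ hs0] at h1
      rw [← h1]
      exact q3 k _ _ _ _
    intro x y
    rw [q6 x, q6 y]
  by_cases hinj : Function.Injective f
  · exact Or.inl ⟨hinj, hf⟩
  right
  suffices H : ∀ x y, f x = f y by
    refine ⟨fun a b => ?_⟩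
    obtain ⟨x, rfl⟩ := hf a
    obtain ⟨y, rfl⟩ := hf b
    exact H x y
  simp only [Function.Injective, not_forall] at hinj
  obtain ⟨⟨i, u, a⟩, ⟨i', u', a'⟩, h, hne⟩ := hinj
  by_cases ha : a = a'
  · subst ha
    by_cases hi : i = i'
    · subst hi
      have hu : u ≠ u' := by
        rintro rfl
        exact hne rfl
      have h1 := hL _ _ (i, u, 0) _ h rfl
      simp only [opL_apply, true_and, if_true, hu, if_false] at h1
      exact c1 _ _ _ _ _ _ (by simp) h1
    · have q1 : ∀ v c, f (i, v, c) = f (i, v + 1, c + (if v = u then 1 else 0)) := by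
        intro v c
        have h1 := hL _ _ (i, v, c) _ h rfl
        simp only [opL_apply, true_and, if_true, hi, if_false, false_and, add_zero] at h1
        have h2 := hT a _ _ _ _ _ _ h1
        simp only [sub_add_cancel] at h2
        exact h2.symm
      have q2 := fiber_const (fun v c => f (i, v, c)) u q1 0 0 0 1
      exact c1 _ _ _ _ _ _ (zero_ne_one) q2
  · exact c1 _ _ _ _ _ _ ha h

end Concrete

/-- for distinct primes `p₁,…,pₙ` and positive integers `m₁,…,mₙ`
with `m₁ + ⋯ + mₙ > n`, there exists a finite simple solution of the YBE of
cardinality `p₁^{m₁} ⋯ pₙ^{mₙ}`. -/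
theorem exists_simple_solution_of_card (n : ℕ) (hn : 0 < n)
    (p m : Fin n → ℕ)
    (hp : ∀ i, (p i).Prime) (hdist : Function.Injective p)
    (hm : ∀ i, 0 < m i) (hsum : n < ∑ i, m i) :
    ∃ (X : Type) (r : X × X → X × X), Finite X ∧
      IsYBSolution r ∧ IsSimpleSolution r ∧
      Nat.card X = ∏ i, p i ^ m i := by
  obtain ⟨i, hi⟩ : ∃ i, 2 ≤ m i := by
    by_contra! hcon
    have : ∑ i, m i ≤ ∑ _i : Fin n, 1 := Finset.sum_le_sum fun i _ => by
      have := hcon i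
      omega
    simp at this
    omega
  obtain ⟨k, hk⟩ : p i ^ 2 ∣ ∏ i, p i ^ m i :=
    (pow_dvd_pow _ hi).trans (Finset.dvd_prod_of_mem (fun i => p i ^ m i) (Finset.mem_univ i))
  have hpos : 0 < ∏ i, p i ^ m i := Finset.prod_pos fun i _ => pow_pos (hp i).pos _
  have hk0 : k ≠ 0 := by
    rintro rfl
    omega
  have : NeZero k := ⟨hk0⟩
  have : Fact (p i).Prime := ⟨hp i⟩
  refine ⟨ZMod (p i) × ZMod k × ZMod (p i), cycR opL, inferInstance,
    cycR_isYB _ opL_cyc opL_gamma, opL_simple, ?_⟩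
  rw [hk]
  simp only [Nat.card_prod, Nat.card_zmod]
  ring
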